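/- arXiv:2312.12449 — 6 statements merged into one kernel-verified Lean document; each statement's English description precedes it below -/
import Mathlib

section
/- Let (A, ≺_λ, ≻_λ, α, β) and (B, ≺'_λ, ≻'_λ, α', β') be two BiHom-dendriform conformal algebras. On the tensor product A ⊗ B define, for p₁, p₂ ∈ A and q₁, q₂ ∈ B: (p₁ ⊗ q₁) ↖_λ (p₂ ⊗ q₂) = (p₁ ≺_λ p₂) ⊗ (q₁ ≺'_λ q₂); (p₁ ⊗ q₁) ↙_λ (p₂ ⊗ q₂) = (p₁ ≺_λ p₂) ⊗ (q₁ ≻'_λ q₂); (p₁ ⊗ q₁) ↗_λ (p₂ ⊗ q₂) = (p₁ ≻_λ p₂) ⊗ (q₁ ≺'_λ q₂); (p₁ ⊗ q₁) ↘_λ (p₂ ⊗ q₂) = (p₁ ≻_λ p₂) ⊗ (q₁ ≻'_λ q₂). Then these four products, together with the structure maps α ⊗ α' and β ⊗ β', satisfy the multiplicativity conditions and the nine BiHom-quadri conformal algebra relations on A ⊗ B (with the derived operations ≺ = ↖ + ↙, ≻ = ↗ + ↘, ∨ = ↙ + ↘, ∧ = ↖ + ↗, * = ↖ + ↙ + ↗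 + ↘). -/
open scoped TensorProduct

/-- A conformally sesquilinear family of `ℂ`-bilinear maps (a "λ-product" when all
spaces and derivations coincide): `f l (D p) q = -l • f l p q` and
`f l p (D q) = D (f l p q) + l • f l p q`. -/
structure ConfSesq {M N P : Type*} [AddCommGroup M] [Module ℂ M]
    [AddCommGroup N] [Module ℂ N] [AddCommGroup P] [Module ℂ P]
    (DM : M →ₗ[ℂ] M) (DN : N →ₗ[ℂ] N) (DP : P →ₗ[ℂ] P)
    (f : ℂ → M → N → P) : Prop where
  add_left : ∀ (l : ℂ) (p p' : M) (q : N), f l (p + p') q = f l p q + f l p' q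
  smul_left : ∀ (l c : ℂ) (p : M) (q : N), f l (c • p) q = c • f l p q
  add_right : ∀ (l : ℂ) (p : M) (q q' : N), f l p (q + q') = f l p q + f l p q'
  smul_right : ∀ (l c : ℂ) (p : M) (q : N), f l p (c • q) = c • f l p q
  sesq_left : ∀ (l : ℂ) (p : M) (q : N), f l (DM p) q = (-l) • f l p q
  sesq_right : ∀ (l : ℂ) (p : M) (q : N), f l p (DN q) = DP (f l p q) + l • f l p q

/-- BiHom-associative conformal algebra. -/
structure BiHomAssocConformal (A : Type*) [AddCommGroup A] [Module ℂ A]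
    (D α β : A →ₗ[ℂ] A) (m : ℂ → A → A → A) : Prop where
  sesq : ConfSesq D D D m
  comm_ab : ∀ p, α (β p) = β (α p)
  comm_aD : ∀ p, α (D p) = D (α p)
  comm_bD : ∀ p, β (D p) = D (β p)
  mult_a : ∀ (l : ℂ) p q, α (m l p q) = m l (α p) (α q)
  mult_b : ∀ (l : ℂ) p q, β (m l p q) = m l (β p) (β q)
  assoc : ∀ (l μ : ℂ) p q r, m l (α p) (m μ q r) = m (l + μ) (m l p q) (β r)

/-- BiHom-dendriform conformal algebra. -/
structure BiHomDendriformConformal (A : Type*) [AddCommGroup A] [Module ℂ A]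
    (D α β : A →ₗ[ℂ] A) (pr su : ℂ → A → A → A) : Prop where
  sesq_pr : ConfSesq D D D pr
  sesq_su : ConfSesq D D D su
  comm_ab : ∀ p, α (β p) = β (α p)
  comm_aD : ∀ p, α (D p) = D (α p)
  comm_bD : ∀ p, β (D p) = D (β p)
  mult_a_pr : ∀ (l : ℂ) p q, α (pr l p q) = pr l (α p) (α q)
  mult_b_pr : ∀ (l : ℂ) p q, β (pr l p q) = pr l (β p) (β q)
  mult_a_su : ∀ (l : ℂ) p q, α (su l p q) = su l (α p) (α q)
  mult_b_su : ∀ (l : ℂ) p q, β (su l p q) = su l (β p) (β q)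
  d1 : ∀ (l μ : ℂ) p q r, pr (l + μ) (pr l p q) (β r) = pr l (α p) (pr μ q r + su μ q r)
  d2 : ∀ (l μ : ℂ) p q r, pr (l + μ) (su l p q) (β r) = su l (α p) (pr μ q r)
  d3 : ∀ (l μ : ℂ) p q r, su l (α p) (su μ q r) = su (l + μ) (pr l p q + su l p q) (β r)

/-- BiHom-tridendriform conformal algebra. -/
structure BiHomTridendriformConformal (A : Type*) [AddCommGroup A] [Module ℂ A]
    (D α β : A →ₗ[ℂ] A) (pr su dt : ℂ → A → A → A) : Prop where
  sesq_pr : ConfSesq D D D pr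
  sesq_su : ConfSesq D D D su
  sesq_dt : ConfSesq D D D dt
  comm_ab : ∀ p, α (β p) = β (α p)
  comm_aD : ∀ p, α (D p) = D (α p)
  comm_bD : ∀ p, β (D p) = D (β p)
  mult_a_pr : ∀ (l : ℂ) p q, α (pr l p q) = pr l (α p) (α q)
  mult_b_pr : ∀ (l : ℂ) p q, β (pr l p q) = pr l (β p) (β q)
  mult_a_su : ∀ (l : ℂ) p q, α (su l p q) = su l (α p) (α q)
  mult_b_su : ∀ (l : ℂ) p q, β (su l p q) = su l (β p) (β q)
  mult_a_dt : ∀ (l : ℂ) p q, α (dt l p q) = dt l (α p) (α q)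
  mult_b_dt : ∀ (l : ℂ) p q, β (dt l p q) = dt l (β p) (β q)
  t1 : ∀ (l μ : ℂ) p q r,
    pr (l + μ) (pr l p q) (β r) = pr l (α p) (pr μ q r + su μ q r + dt μ q r)
  t2 : ∀ (l μ : ℂ) p q r, pr (l + μ) (su l p q) (β r) = su l (α p) (pr μ q r)
  t3 : ∀ (l μ : ℂ) p q r,
    su l (α p) (su μ q r) = su (l + μ) (pr l p q + su l p q + dt l p q) (β r)
  t4 : ∀ (l μ : ℂ) p q r, dt l (α p) (su μ q r) = dt (l + μ) (pr l p q) (β r)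
  t5 : ∀ (l μ : ℂ) p q r, su l (α p) (dt μ q r) = dt (l + μ) (su l p q) (β r)
  t6 : ∀ (l μ : ℂ) p q r, dt l (α p) (pr μ q r) = pr (l + μ) (dt l p q) (β r)
  t7 : ∀ (l μ : ℂ) p q r, dt l (α p) (dt μ q r) = dt (l + μ) (dt l p q) (β r)

/-- BiHom-NS-conformal algebra. -/
structure BiHomNSConformal (A : Type*) [AddCommGroup A] [Module ℂ A]
    (D α β : A →ₗ[ℂ] A) (pr su ve : ℂ → A → A → A) : Prop where
  sesq_pr : ConfSesq D D D pr
  sesq_su : ConfSesq D D D su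
  sesq_ve : ConfSesq D D D ve
  comm_ab : ∀ p, α (β p) = β (α p)
  comm_aD : ∀ p, α (D p) = D (α p)
  comm_bD : ∀ p, β (D p) = D (β p)
  mult_a_pr : ∀ (l : ℂ) p q, α (pr l p q) = pr l (α p) (α q)
  mult_b_pr : ∀ (l : ℂ) p q, β (pr l p q) = pr l (β p) (β q)
  mult_a_su : ∀ (l : ℂ) p q, α (su l p q) = su l (α p) (α q)
  mult_b_su : ∀ (l : ℂ) p q, β (su l p q) = su l (β p) (β q)
  mult_a_ve : ∀ (l : ℂ) p q, α (ve l p q) = ve l (α p) (α q)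
  mult_b_ve : ∀ (l : ℂ) p q, β (ve l p q) = ve l (β p) (β q)
  ns1 : ∀ (l μ : ℂ) p q r,
    pr (l + μ) (pr l p q) (β r) = pr l (α p) (pr μ q r + su μ q r + ve μ q r)
  ns2 : ∀ (l μ : ℂ) p q r, pr (l + μ) (su l p q) (β r) = su l (α p) (pr μ q r)
  ns3 : ∀ (l μ : ℂ) p q r,
    su (l + μ) (pr l p q + su l p q + ve l p q) (β r) = su l (α p) (su μ q r)
  ns4 : ∀ (l μ : ℂ) p q r,
    pr (l + μ) (ve l p q) (β r) + ve (l + μ) (pr l p q + su l p q + ve l p q) (β r)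
      = su l (α p) (ve μ q r) + ve l (α p) (pr μ q r + su μ q r + ve μ q r)

/-- Conformal bimodule over a BiHom-associative conformal algebra. -/
structure ConformalBimodule (A M : Type*) [AddCommGroup A] [Module ℂ A]
    [AddCommGroup M] [Module ℂ M]
    (DA αA βA : A →ₗ[ℂ] A) (mA : ℂ → A → A → A)
    (DM αM βM : M →ₗ[ℂ] M)
    (lact : ℂ → A → M → M) (ract : ℂ → M → A → M) : Prop where
  sesq_l : ConfSesq DA DM DM lact
  sesq_r : ConfSesq DM DA DM ract
  comm_ab : ∀ x, αM (βM x) = βM (αM x)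
  l_a : ∀ (l : ℂ) p x, αM (lact l p x) = lact l (αA p) (αM x)
  l_b : ∀ (l : ℂ) p x, βM (lact l p x) = lact l (βA p) (βM x)
  r_a : ∀ (l : ℂ) x p, αM (ract l x p) = ract l (αM x) (αA p)
  r_b : ∀ (l : ℂ) x p, βM (ract l x p) = ract l (βM x) (βA p)
  assoc_ll : ∀ (l μ : ℂ) p q x, lact (l + μ) (mA l p q) (βM x) = lact l (αA p) (lact μ q x)
  assoc_rr : ∀ (l μ : ℂ) x p q, ract (l + μ) (ract l x p) (βA q) = ract l (αM x) (mA μ p q)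
  assoc_lr : ∀ (l μ : ℂ) p x q, ract (l + μ) (lact l p x) (βA q) = lact l (αA p) (ract μ x q)

/-- The multiplicativity conditions and the nine BiHom-quadri relations. -/
structure BiHomQuadriRel (Q : Type*) [AddCommGroup Q] [Module ℂ Q]
    (α β : Q →ₗ[ℂ] Q) (nw sw ne se : ℂ → Q → Q → Q) : Prop where
  mult_a_nw : ∀ (l : ℂ) p q, α (nw l p q) = nw l (α p) (α q)
  mult_b_nw : ∀ (l : ℂ) p q, β (nw l p q) = nw l (β p) (β q)
  mult_a_sw : ∀ (l : ℂ) p q, α (sw l p q) = sw l (α p) (α q)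
  mult_b_sw : ∀ (l : ℂ) p q, β (sw l p q) = sw l (β p) (β q)
  mult_a_ne : ∀ (l : ℂ) p q, α (ne l p q) = ne l (α p) (α q)
  mult_b_ne : ∀ (l : ℂ) p q, β (ne l p q) = ne l (β p) (β q)
  mult_a_se : ∀ (l : ℂ) p q, α (se l p q) = se l (α p) (α q)
  mult_b_se : ∀ (l : ℂ) p q, β (se l p q) = se l (β p) (β q)
  q1 : ∀ (l μ : ℂ) p q r, nw (l + μ) (nw l p q) (β r)
        = nw l (α p) (nw μ q r + sw μ q r + ne μ q r + se μ q r)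
  q2 : ∀ (l μ : ℂ) p q r, nw (l + μ) (ne l p q) (β r) = ne l (α p) (nw μ q r + sw μ q r)
  q3 : ∀ (l μ : ℂ) p q r, ne (l + μ) (nw l p q + ne l p q) (β r)
        = ne l (α p) (ne μ q r + se μ q r)
  q4 : ∀ (l μ : ℂ) p q r, nw (l + μ) (sw l p q) (β r) = sw l (α p) (nw μ q r + ne μ q r)
  q5 : ∀ (l μ : ℂ) p q r, ne (l + μ) (sw l p q + se l p q) (β r) = se l (α p) (ne μ q r)
  q6 : ∀ (l μ : ℂ) p q r, nw (l + μ) (se l p q) (β r) = se l (α p) (nw μ q r)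
  q7 : ∀ (l μ : ℂ) p q r, sw (l + μ) (nw l p q + sw l p q) (β r)
        = sw l (α p) (sw μ q r + se μ q r)
  q8 : ∀ (l μ : ℂ) p q r, se (l + μ) (nw l p q + sw l p q + ne l p q + se l p q) (β r)
        = se l (α p) (se μ q r)
  q9 : ∀ (l μ : ℂ) p q r, sw (l + μ) (ne l p q + se l p q) (β r) = se l (α p) (sw μ q r)

/-- BiHom-quadri conformal algebra. -/
structure BiHomQuadriConformal (Q : Type*) [AddCommGroup Q] [Module ℂ Q]
    (D α β : Q →ₗ[ℂ] Q) (nw sw ne se : ℂ → Q → Q → Q) : Prop where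
  sesq_nw : ConfSesq D D D nw
  sesq_sw : ConfSesq D D D sw
  sesq_ne : ConfSesq D D D ne
  sesq_se : ConfSesq D D D se
  comm_ab : ∀ p, α (β p) = β (α p)
  comm_aD : ∀ p, α (D p) = D (α p)
  comm_bD : ∀ p, β (D p) = D (β p)
  rel : BiHomQuadriRel Q α β nw sw ne se

/-- Rota-Baxter operator of weight `θ` on a conformal algebra with λ-product `m`. -/
structure RotaBaxterWeight (A : Type*) [AddCommGroup A] [Module ℂ A]
    (D : A →ₗ[ℂ] A) (m : ℂ → A → A → A) (θ : ℂ) (Rop : A →ₗ[ℂ] A) : Prop where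
  comm_D : ∀ p, Rop (D p) = D (Rop p)
  rb : ∀ (l : ℂ) p q,
    m l (Rop p) (Rop q) = Rop (m l (Rop p) q + m l p (Rop q) + θ • m l p q)

/-- Rota-Baxter system on a BiHom-associative conformal algebra. -/
structure RotaBaxterSystem (A : Type*) [AddCommGroup A] [Module ℂ A]
    (D α β : A →ₗ[ℂ] A) (m : ℂ → A → A → A) (Rop Sop : A →ₗ[ℂ] A) : Prop where
  R_D : ∀ p, Rop (D p) = D (Rop p)
  S_D : ∀ p, Sop (D p) = D (Sop p)
  R_a : ∀ p, Rop (α p) = α (Rop p)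
  R_b : ∀ p, Rop (β p) = β (Rop p)
  S_a : ∀ p, Sop (α p) = α (Sop p)
  S_b : ∀ p, Sop (β p) = β (Sop p)
  rb_R : ∀ (l : ℂ) p q, m l (Rop p) (Rop q) = Rop (m l (Rop p) q + m l p (Sop q))
  rb_S : ∀ (l : ℂ) p q, m l (Sop p) (Sop q) = Sop (m l (Rop p) q + m l p (Sop q))

/-- Rota-Baxter operator of weight 0 on a BiHom-dendriform conformal algebra. -/
structure RotaBaxterDendriform (A : Type*) [AddCommGroup A] [Module ℂ A]
    (D α β : A →ₗ[ℂ] A) (pr su : ℂ → A → A → A) (Rop : A →ₗ[ℂ] A) : Prop where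
  comm_D : ∀ p, Rop (D p) = D (Rop p)
  comm_a : ∀ p, Rop (α p) = α (Rop p)
  comm_b : ∀ p, Rop (β p) = β (Rop p)
  rb_su : ∀ (l : ℂ) p q, su l (Rop p) (Rop q) = Rop (su l p (Rop q) + su l (Rop p) q)
  rb_pr : ∀ (l : ℂ) p q, pr l (Rop p) (Rop q) = Rop (pr l p (Rop q) + pr l (Rop p) q)

/-- Rota-Baxter system on a BiHom-dendriform conformal algebra. -/
structure RotaBaxterSystemDendriform (A : Type*) [AddCommGroup A] [Module ℂ A]
    (D α β : A →ₗ[ℂ] A) (pr su : ℂ → A → A → A) (Rop Sop : A →ₗ[ℂ] A) : Prop where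
  R_D : ∀ p, Rop (D p) = D (Rop p)
  S_D : ∀ p, Sop (D p) = D (Sop p)
  R_a : ∀ p, Rop (α p) = α (Rop p)
  R_b : ∀ p, Rop (β p) = β (Rop p)
  S_a : ∀ p, Sop (α p) = α (Sop p)
  S_b : ∀ p, Sop (β p) = β (Sop p)
  rs_su_R : ∀ (l : ℂ) p q, su l (Rop p) (Rop q) = Rop (su l p (Sop q) + su l (Rop p) q)
  rs_pr_R : ∀ (l : ℂ) p q, pr l (Rop p) (Rop q) = Rop (pr l p (Sop q) + pr l (Rop p) q)
  rs_su_S : ∀ (l : ℂ) p q, su l (Sop p) (Sop q) = Sop (su l p (Sop q) + su l (Rop p) q)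
  rs_pr_S : ∀ (l : ℂ) p q, pr l (Sop p) (Sop q) = Sop (pr l p (Sop q) + pr l (Rop p) q)

/-- Hochschild 2-cocycle on a BiHom-associative conformal algebra with coefficients in
a conformal bimodule. -/
structure Hochschild2Cocycle (A M : Type*) [AddCommGroup A] [Module ℂ A]
    [AddCommGroup M] [Module ℂ M]
    (DA αA βA : A →ₗ[ℂ] A) (mA : ℂ → A → A → A)
    (DM αM βM : M →ₗ[ℂ] M)
    (lact : ℂ → A → M → M) (ract : ℂ → M → A → M)
    (H : ℂ → A → A → M) : Prop where
  sesq : ConfSesq DA DA DM H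
  comm_a : ∀ (l : ℂ) p q, H l (αA p) (αA q) = αM (H l p q)
  comm_b : ∀ (l : ℂ) p q, H l (βA p) (βA q) = βM (H l p q)
  cocycle : ∀ (l μ : ℂ) p q r,
    lact l (αA p) (H μ q r) - H (l + μ) (mA l p q) (βA r)
      + H l (αA p) (mA μ q r) - ract (l + μ) (H l p q) (βA r) = 0

/-- `H`-twisted Rota-Baxter operator `R : M → A`. -/
structure TwistedRotaBaxter (A M : Type*) [AddCommGroup A] [Module ℂ A]
    [AddCommGroup M] [Module ℂ M]
    (DA αA βA : A →ₗ[ℂ] A) (mA : ℂ → A → A → A)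
    (DM αM βM : M →ₗ[ℂ] M)
    (lact : ℂ → A → M → M) (ract : ℂ → M → A → M)
    (H : ℂ → A → A → M) (Rop : M →ₗ[ℂ] A) : Prop where
  comm_D : ∀ x, Rop (DM x) = DA (Rop x)
  comm_a : ∀ x, Rop (αM x) = αA (Rop x)
  comm_b : ∀ x, Rop (βM x) = βA (Rop x)
  twisted : ∀ (l : ℂ) x y, mA l (Rop x) (Rop y)
      = Rop (ract l x (Rop y) + lact l (Rop x) y + H l (Rop x) (Rop y))


/-- Two biadditive maps agreeing on pure tensors agree. -/
theorem tpq_ext2 {A B Q : Type*} [AddCommGroup A] [Module ℂ A]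
    [AddCommGroup B] [Module ℂ B] [AddCommGroup Q]
    (F G : (A ⊗[ℂ] B) → (A ⊗[ℂ] B) → Q)
    (hF1 : ∀ x x' y, F (x + x') y = F x y + F x' y)
    (hF2 : ∀ x y y', F x (y + y') = F x y + F x y')
    (hG1 : ∀ x x' y, G (x + x') y = G x y + G x' y)
    (hG2 : ∀ x y y', G x (y + y') = G x y + G x y')
    (h : ∀ a b a' b', F (a ⊗ₜ[ℂ] b) (a' ⊗ₜ[ℂ] b') = G (a ⊗ₜ[ℂ] b) (a' ⊗ₜ[ℂ] b')) :
    ∀ x y, F x y = G x y := by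
  intro x y
  induction x using TensorProduct.induction_on with
  | zero =>
    have h1 := hF1 0 0 y
    have h2 := hG1 0 0 y
    simp only [add_zero, left_eq_add] at h1 h2
    rw [h1, h2]
  | add x x' hx hx' => rw [hF1, hG1, hx, hx']
  | tmul a b =>
    induction y using TensorProduct.induction_on with
    | zero =>
      have h1 := hF2 (a ⊗ₜ[ℂ] b) 0 0
      have h2 := hG2 (a ⊗ₜ[ℂ] b) 0 0
      simp only [add_zero, left_eq_add] at h1 h2
      rw [h1, h2]
    | add y y' hy hy' => rw [hF2, hG2, hy, hy']
    | tmul a' b' => exact h a b _ _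

/-- Two triadditive maps agreeing on pure tensors agree. -/
theorem tpq_ext3 {A B Q : Type*} [AddCommGroup A] [Module ℂ A]
    [AddCommGroup B] [Module ℂ B] [AddCommGroup Q]
    (F G : (A ⊗[ℂ] B) → (A ⊗[ℂ] B) → (A ⊗[ℂ] B) → Q)
    (hF1 : ∀ x x' y z, F (x + x') y z = F x y z + F x' y z)
    (hF2 : ∀ x y y' z, F x (y + y') z = F x y z + F x y' z)
    (hF3 : ∀ x y z z', F x y (z + z') = F x y z + F x y z')
    (hG1 : ∀ x x' y z, G (x + x') y z = G x y z + G x' y z)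
    (hG2 : ∀ x y y' z, G x (y + y') z = G x y z + G x y' z)
    (hG3 : ∀ x y z z', G x y (z + z') = G x y z + G x y z')
    (h : ∀ a b a' b' a'' b'', F (a ⊗ₜ[ℂ] b) (a' ⊗ₜ[ℂ] b') (a'' ⊗ₜ[ℂ] b'')
      = G (a ⊗ₜ[ℂ] b) (a' ⊗ₜ[ℂ] b') (a'' ⊗ₜ[ℂ] b'')) :
    ∀ x y z, F x y z = G x y z := by
  intro x y z
  induction x using TensorProduct.induction_on with
  | zero =>
    have h1 := hF1 0 0 y z
    have h2 := hG1 0 0 y z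
    simp only [add_zero, left_eq_add] at h1 h2
    rw [h1, h2]
  | add x x' hx hx' => rw [hF1, hG1, hx, hx']
  | tmul a b =>
    exact tpq_ext2 (F (a ⊗ₜ[ℂ] b)) (G (a ⊗ₜ[ℂ] b)) (hF2 _) (hF3 _) (hG2 _) (hG3 _)
      (h a b) y z

/-- the tensor product of two BiHom-dendriform conformal algebras,
with the four products defined componentwise on pure tensors, satisfies the
multiplicativity conditions and the nine BiHom-quadri conformal algebra relations. -/
theorem tensor_product_quadri (A B : Type*) [AddCommGroup A] [Module ℂ A]
    [AddCommGroup B] [Module ℂ B]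
    (DA αA βA : A →ₗ[ℂ] A) (prA suA : ℂ → A → A → A)
    (DB αB βB : B →ₗ[ℂ] B) (prB suB : ℂ → B → B → B)
    (hA : BiHomDendriformConformal A DA αA βA prA suA)
    (hB : BiHomDendriformConformal B DB αB βB prB suB)
    (nw sw ne se : ℂ → (A ⊗[ℂ] B) → (A ⊗[ℂ] B) → (A ⊗[ℂ] B))
    -- the four products are ℂ-bilinear:
    (hnw_add_l : ∀ (l : ℂ) x x' y, nw l (x + x') y = nw l x y + nw l x' y)
    (hnw_smul_l : ∀ (l c : ℂ) x y, nw l (c • x) y = c • nw l x y)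
    (hnw_add_r : ∀ (l : ℂ) x y y', nw l x (y + y') = nw l x y + nw l x y')
    (hnw_smul_r : ∀ (l c : ℂ) x y, nw l x (c • y) = c • nw l x y)
    (hsw_add_l : ∀ (l : ℂ) x x' y, sw l (x + x') y = sw l x y + sw l x' y)
    (hsw_smul_l : ∀ (l c : ℂ) x y, sw l (c • x) y = c • sw l x y)
    (hsw_add_r : ∀ (l : ℂ) x y y', sw l x (y + y') = sw l x y + sw l x y')
    (hsw_smul_r : ∀ (l c : ℂ) x y, sw l x (c • y) = c • sw l x y)
    (hne_add_l : ∀ (l : ℂ) x x' y, ne l (x + x') y = ne l x y + ne l x' y)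
    (hne_smul_l : ∀ (l c : ℂ) x y, ne l (c • x) y = c • ne l x y)
    (hne_add_r : ∀ (l : ℂ) x y y', ne l x (y + y') = ne l x y + ne l x y')
    (hne_smul_r : ∀ (l c : ℂ) x y, ne l x (c • y) = c • ne l x y)
    (hse_add_l : ∀ (l : ℂ) x x' y, se l (x + x') y = se l x y + se l x' y)
    (hse_smul_l : ∀ (l c : ℂ) x y, se l (c • x) y = c • se l x y)
    (hse_add_r : ∀ (l : ℂ) x y y', se l x (y + y') = se l x y + se l x y')
    (hse_smul_r : ∀ (l c : ℂ) x y, se l x (c • y) = c • se l x y)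
    -- values on pure tensors:
    (hnw : ∀ (l : ℂ) (p₁ p₂ : A) (q₁ q₂ : B),
      nw l (p₁ ⊗ₜ[ℂ] q₁) (p₂ ⊗ₜ[ℂ] q₂) = (prA l p₁ p₂) ⊗ₜ[ℂ] (prB l q₁ q₂))
    (hsw : ∀ (l : ℂ) (p₁ p₂ : A) (q₁ q₂ : B),
      sw l (p₁ ⊗ₜ[ℂ] q₁) (p₂ ⊗ₜ[ℂ] q₂) = (prA l p₁ p₂) ⊗ₜ[ℂ] (suB l q₁ q₂))
    (hne : ∀ (l : ℂ) (p₁ p₂ : A) (q₁ q₂ : B),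
      ne l (p₁ ⊗ₜ[ℂ] q₁) (p₂ ⊗ₜ[ℂ] q₂) = (suA l p₁ p₂) ⊗ₜ[ℂ] (prB l q₁ q₂))
    (hse : ∀ (l : ℂ) (p₁ p₂ : A) (q₁ q₂ : B),
      se l (p₁ ⊗ₜ[ℂ] q₁) (p₂ ⊗ₜ[ℂ] q₂) = (suA l p₁ p₂) ⊗ₜ[ℂ] (suB l q₁ q₂)) :
    BiHomQuadriRel (A ⊗[ℂ] B) (TensorProduct.map αA αB) (TensorProduct.map βA βB)
      nw sw ne se := by
  have eA1 := fun l μ p q r => (hA.d1 l μ p q r).trans (hA.sesq_pr.add_right _ _ _ _)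
  have eB1 := fun l μ p q r => (hB.d1 l μ p q r).trans (hB.sesq_pr.add_right _ _ _ _)
  have eA3 := fun l μ p q r => (hA.d3 l μ p q r).trans (hA.sesq_su.add_left _ _ _ _)
  have eB3 := fun l μ p q r => (hB.d3 l μ p q r).trans (hB.sesq_su.add_left _ _ _ _)
  constructor
  iterate 8
    intro l
    refine tpq_ext2 _ _ ?_ ?_ ?_ ?_ ?_
    iterate 4
      intros
      simp only [hnw_add_l, hnw_add_r, hsw_add_l, hsw_add_r, 
        hne_add_l, hne_add_r, hse_add_l, hse_add_r, map_add]
    intros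
    simp only [hnw, hsw, hne, hse, TensorProduct.map_tmul, hA.mult_a_pr, hA.mult_b_pr,
      hA.mult_a_su, hA.mult_b_su, hB.mult_a_pr, hB.mult_b_pr, hB.mult_a_su, hB.mult_b_su]
  all_goals
    intro l μ
    refine tpq_ext3 _ _ ?_ ?_ ?_ ?_ ?_ ?_ ?_
    iterate 6
      intros
      simp only [hnw_add_l, hnw_add_r, hsw_add_l, hsw_add_r, 
        hne_add_l, hne_add_r, hse_add_l, hse_add_r, map_add] <;> abel
    intros
    simp only [hnw_add_l, hnw_add_r, hsw_add_l, hsw_add_r, 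
        hne_add_l, hne_add_r, hse_add_l, hse_add_r, map_add,
      hnw, hsw, hne, hse, TensorProduct.map_tmul, eA1, eB1, hA.d2, hB.d2, eA3, eB3,
      TensorProduct.add_tmul, TensorProduct.tmul_add] <;> abel
end

section
/- Let (D, ≺_λ, ≻_λ, α, β) be a BiHom-dendriform conformal algebra and R : D → D a Rota-Baxter operator of weight 0 on it. Define p ↘_λ q = R(p) ≻_λ q, p ↗_λ q = p ≻_λ R(q), p ↙_λ q = R(p) ≺_λ q, and p ↖_λ q = p ≺_λ R(q). Then (D, ↖_λ, ↙_λ, ↗_λ, ↘_λ, α, β) is a BiHom-quadri conformal algebra. -/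
open scoped TensorProduct

/-- a Rota-Baxter operator of weight 0 on a BiHom-dendriform conformal
algebra yields a BiHom-quadri conformal algebra via
`p ↘ q = R(p) ≻ q`, `p ↗ q = p ≻ R(q)`, `p ↙ q = R(p) ≺ q`, `p ↖ q = p ≺ R(q)`. -/
theorem rota_baxter_dendriform_to_quadri (D : Type*) [AddCommGroup D] [Module ℂ D]
    (Dd α β : D →ₗ[ℂ] D) (pr su : ℂ → D → D → D) (Rop : D →ₗ[ℂ] D)
    (h : BiHomDendriformConformal D Dd α β pr su)
    (hR : RotaBaxterDendriform D Dd α β pr su Rop) :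
    BiHomQuadriConformal D Dd α β
      (fun l p q => pr l p (Rop q)) (fun l p q => pr l (Rop p) q)
      (fun l p q => su l p (Rop q)) (fun l p q => su l (Rop p) q) := by
  have hp := h.sesq_pr
  have hs := h.sesq_su
  have e4 : ∀ (l : ℂ) (p q : D),
      Rop (pr l p (Rop q) + pr l (Rop p) q + su l p (Rop q) + su l (Rop p) q)
        = pr l (Rop p) (Rop q) + su l (Rop p) (Rop q) := by
    intro l p q
    rw [hR.rb_pr, hR.rb_su, ← map_add]
    congr 1
    abel
  refine ⟨?_, ?_, ?_, ?_, h.comm_ab, h.comm_aD, h.comm_bD, ?_⟩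
  · constructor <;> intros <;>
      simp only [map_add, map_smul, hR.comm_D, hp.add_left, hp.add_right, hp.smul_left,
        hp.smul_right, hp.sesq_left, hp.sesq_right]
  · constructor <;> intros <;>
      simp only [map_add, map_smul, hR.comm_D, hp.add_left, hp.add_right, hp.smul_left,
        hp.smul_right, hp.sesq_left, hp.sesq_right]
  · constructor <;> intros <;>
      simp only [map_add, map_smul, hR.comm_D, hs.add_left, hs.add_right, hs.smul_left,
        hs.smul_right, hs.sesq_left, hs.sesq_right]
  · constructor <;> intros <;>
      simp only [map_add, map_smul, hR.comm_D, hs.add_left, hs.add_right, hs.smul_left,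
        hs.smul_right, hs.sesq_left, hs.sesq_right]
  constructor
  case q1 => intro l μ p q r; simp only [e4, hR.comm_b, h.d1]
  case q2 => intro l μ p q r; simp only [← hR.rb_pr, hR.comm_b, h.d2]
  case q3 => intro l μ p q r; simp only [← hR.rb_su, hR.comm_b, h.d3]
  case q4 => intro l μ p q r; simp only [hR.comm_b, hR.comm_a, h.d1]
  case q5 => intro l μ p q r; simp only [hR.comm_b, hR.comm_a, h.d3]
  case q6 => intro l μ p q r; simp only [hR.comm_b, hR.comm_a, h.d2]
  case q7 => intro l μ p q r; simp only [← hR.rb_pr, hR.comm_a, h.d1]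
  case q8 => intro l μ p q r; simp only [e4, hR.comm_a, h.d3]
  case q9 => intro l μ p q r; simp only [← hR.rb_su, hR.comm_a, h.d2]
  all_goals
    intro l p q
    simp only [hR.comm_a, hR.comm_b, h.mult_a_pr, h.mult_b_pr, h.mult_a_su, h.mult_b_su]
end

section
/- Let (A, ·_λ, α, β) be a BiHom-associative conformal algebra and let R, P : A → A be two commuting Rota-Baxter operators of weight 0 on it, each commuting with α and β. Let (A, ≺^R_λ, ≻^R_λ, α, β) be the BiHom-dendriform conformal algebra with p ≺^R_λ q = p ·_λ R(q) and p ≻^R_λ q = R(p) ·_λ q. Then P is a Rota-Baxter operator of weight 0 on the BiHom-dendriform conformal algebra (A, ≺^R_λ, ≻^R_λ, α, β), i.e. P(p) ≻^R_λ P(q) = P(p ≻^R_λ P(q) + P(p) ≻^R_λ q) and P(p) ≺^R_λ P(q) = P(p ≺^R_λ P(q) + P(p) ≺^R_λ q) for all p, q ∈ A and λ ∈ ℂ. -/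
open scoped TensorProduct

/-- if `R, P` are commuting Rota-Baxter operators of weight 0 on a
BiHom-associative conformal algebra (each commuting with `α, β`), then `P` is a
Rota-Baxter operator of weight 0 on the BiHom-dendriform conformal algebra
`(A, ≺^R, ≻^R, α, β)` where `p ≺^R q = p · R(q)` and `p ≻^R q = R(p) · q`. -/
theorem commuting_rota_baxter_on_dendriform (A : Type*) [AddCommGroup A] [Module ℂ A]
    (D α β Rop Pop : A →ₗ[ℂ] A) (m : ℂ → A → A → A)
    (hA : BiHomAssocConformal A D α β m)
    (hR : RotaBaxterWeight A D m 0 Rop)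
    (hP : RotaBaxterWeight A D m 0 Pop)
    (hRP : ∀ p, Rop (Pop p) = Pop (Rop p))
    (hRa : ∀ p, Rop (α p) = α (Rop p)) (hRb : ∀ p, Rop (β p) = β (Rop p))
    (hPa : ∀ p, Pop (α p) = α (Pop p)) (hPb : ∀ p, Pop (β p) = β (Pop p)) :
    RotaBaxterDendriform A D α β
      (fun l p q => m l p (Rop q)) (fun l p q => m l (Rop p) q) Pop := by
  refine ⟨hP.comm_D, hPa, hPb, fun l p q => ?_, fun l p q => ?_⟩
  · have h := hP.rb l (Rop p) q
    rw [zero_smul, add_zero] at h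
    simp only [hRP]
    rw [h, add_comm]
  · have h := hP.rb l p (Rop q)
    rw [zero_smul, add_zero] at h
    simp only [hRP]
    rw [h, add_comm]
end

section
/- Let (A, ·_λ, α, β) be a BiHom-associative conformal algebra and let (A, α, β, R, S) be a Rota-Baxter system on it. Define p ≺_λ q = p ·_λ S(q) and p ≻_λ q = R(p) ·_λ q. Then (A, ≺_λ, ≻_λ, α, β) is a BiHom-dendriform conformal algebra. -/
open scoped TensorProduct

/-- a Rota-Baxter system `(A, α, β, R, S)` on a BiHom-associative
conformal algebra yields a BiHom-dendriform conformal algebra via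
`p ≺ q = p · S(q)` and `p ≻ q = R(p) · q`. -/
theorem rota_baxter_system_to_dendriform (A : Type*) [AddCommGroup A] [Module ℂ A]
    (D α β Rop Sop : A →ₗ[ℂ] A) (m : ℂ → A → A → A)
    (hA : BiHomAssocConformal A D α β m)
    (hRS : RotaBaxterSystem A D α β m Rop Sop) :
    BiHomDendriformConformal A D α β
      (fun l p q => m l p (Sop q)) (fun l p q => m l (Rop p) q) := by
  obtain ⟨⟨al, sl, ar, sr, dl, dr⟩, cab, caD, cbD, ma, mb, as⟩ := hA
  obtain ⟨RD, SD, Ra, Rb, Sa, Sb, rR, rS⟩ := hRS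
  refine ⟨⟨?_, ?_, ?_, ?_, ?_, ?_⟩, ⟨?_, ?_, ?_, ?_, ?_, ?_⟩, cab, caD, cbD,
    ?_, ?_, ?_, ?_, ?_, ?_, ?_⟩
  · intro l p p' q; exact al _ _ _ _
  · intro l c p q; exact sl _ _ _ _
  · intro l p q q'; simp only [map_add, ar]
  · intro l c p q; simp only [map_smul, sr]
  · intro l p q; exact dl _ _ _
  · intro l p q; simp only [SD, dr]
  · intro l p p' q; simp only [map_add, al]
  · intro l c p q; simp only [map_smul, sl]
  · intro l p q q'; exact ar _ _ _ _
  · intro l c p q; exact sr _ _ _ _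
  · intro l p q; simp only [RD, dl]
  · intro l p q; exact dr _ _ _
  · intro l p q; simp only [ma, Sa]
  · intro l p q; simp only [mb, Sb]
  · intro l p q; simp only [ma, Ra]
  · intro l p q; simp only [mb, Rb]
  · intro l μ p q r
    change m (l + μ) (m l p (Sop q)) (Sop (β r))
      = m l (α p) (Sop (m μ q (Sop r) + m μ (Rop q) r))
    rw [Sb, ← as, rS, add_comm (m μ (Rop q) r)]
  · intro l μ p q r
    change m (l + μ) (m l (Rop p) q) (Sop (β r)) = m l (Rop (α p)) (m μ q (Sop r))
    rw [Sb, ← as, Ra]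
  · intro l μ p q r
    change m l (Rop (α p)) (m μ (Rop q) r)
      = m (l + μ) (Rop (m l p (Sop q) + m l (Rop p) q)) (β r)
    rw [Ra, as, rR, add_comm (m l (Rop p) q)]
end

section
/- Let (D, ≺_λ, ≻_λ, α, β) be a BiHom-dendriform conformal algebra and let (D, ≺_λ, ≻_λ, α, β, R, S) be a Rota-Baxter system on it. Define p ↘_λ q = R(p) ≻_λ q, p ↗_λ q = p ≻_λ S(q), p ↙_λ q = R(p) ≺_λ q, and p ↖_λ q = p ≺_λ S(q). Then (D, ↖_λ, ↙_λ, ↗_λ, ↘_λ, α, β) is a BiHom-quadri conformal algebra. -/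
open scoped TensorProduct

/-- a Rota-Baxter system on a BiHom-dendriform conformal algebra yields
a BiHom-quadri conformal algebra via `p ↘ q = R(p) ≻ q`, `p ↗ q = p ≻ S(q)`,
`p ↙ q = R(p) ≺ q`, `p ↖ q = p ≺ S(q)`. -/
theorem rota_baxter_system_dendriform_to_quadri (D : Type*) [AddCommGroup D] [Module ℂ D]
    (Dd α β : D →ₗ[ℂ] D) (pr su : ℂ → D → D → D) (Rop Sop : D →ₗ[ℂ] D)
    (h : BiHomDendriformConformal D Dd α β pr su)
    (hRS : RotaBaxterSystemDendriform D Dd α β pr su Rop Sop) :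
    BiHomQuadriConformal D Dd α β
      (fun l p q => pr l p (Sop q)) (fun l p q => pr l (Rop p) q)
      (fun l p q => su l p (Sop q)) (fun l p q => su l (Rop p) q) := by
  obtain ⟨hp, hs, ab, aD, bD, ap, bp, as, bs, d1, d2, d3⟩ := h
  obtain ⟨RD, SD, Ra, Rb, Sa, Sb, sR, pR, sS, pS⟩ := hRS
  obtain ⟨p1, p2, p3, p4, p5, p6⟩ := hp
  obtain ⟨s1, s2, s3, s4, s5, s6⟩ := hs
  have sum4S : ∀ (μ : ℂ) (q r : D), Sop (pr μ q (Sop r) + pr μ (Rop q) r + su μ q (Sop r)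
      + su μ (Rop q) r) = pr μ (Sop q) (Sop r) + su μ (Sop q) (Sop r) := by
    intro μ q r
    rw [pS, sS, ← map_add, add_assoc (pr μ q (Sop r) + pr μ (Rop q) r)]
  have sum4R : ∀ (μ : ℂ) (q r : D), Rop (pr μ q (Sop r) + pr μ (Rop q) r + su μ q (Sop r)
      + su μ (Rop q) r) = pr μ (Rop q) (Rop r) + su μ (Rop q) (Rop r) := by
    intro μ q r
    rw [pR, sR, ← map_add, add_assoc (pr μ q (Sop r) + pr μ (Rop q) r)]
  refine ⟨?_, ?_, ?_, ?_, ab, aD, bD, ?_⟩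
  · constructor <;> intros <;> simp only [map_add, map_smul, SD, p1, p2, p3, p4, p5, p6]
  · constructor <;> intros <;> simp only [map_add, map_smul, RD, p1, p2, p3, p4, p5, p6]
  · constructor <;> intros <;> simp only [map_add, map_smul, SD, s1, s2, s3, s4, s5, s6]
  · constructor <;> intros <;> simp only [map_add, map_smul, RD, s1, s2, s3, s4, s5, s6]
  · constructor
    · intro l p q; simp only [ap, Sa]
    · intro l p q; simp only [bp, Sb]
    · intro l p q; simp only [ap, Ra]
    · intro l p q; simp only [bp, Rb]
    · intro l p q; simp only [as, Sa]
    · intro l p q; simp only [bs, Sb]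
    · intro l p q; simp only [as, Ra]
    · intro l p q; simp only [bs, Rb]
    · intro l μ p q r; simp only [sum4S, Sb, d1]
    · intro l μ p q r; simp only [← pS, Sb, d2]
    · intro l μ p q r; simp only [← sS, Sb, d3]
    · intro l μ p q r; simp only [Sb, Ra, d1]
    · intro l μ p q r; simp only [Sb, Ra, d3]
    · intro l μ p q r; simp only [Sb, Ra, d2]
    · intro l μ p q r; simp only [← pR, Ra, d1]
    · intro l μ p q r; simp only [sum4R, Ra, d3]
    · intro l μ p q r; simp only [← sR, Ra, d2]
end

section
/- Let (A, ·_λ, α, β) be a BiHom-associative conformal algebra and let (A, α, β, R, S) and (A, α, β, R', S') be two Rota-Baxter systems on it such that SS' = S'S, RS' = S'R, SR' = R'S, and RR' = R'R. Let (A, ≺^R_λ, ≻^R_λ, α, β) be the BiHom-dendriform conformal algebra with p ≺^R_λ q = p ·_λ S(q) and p ≻^R_λ q = R(p) ·_λ q. Then (R', S') is a Rota-Baxter system on the BiHom-dendriform conformal algebra (A, ≺^R_λ, ≻^R_λ, α, β), i.e. R'(p) ≻^R_λ R'(q) = R'(p ≻^R_λ S'(q) + R'(p) ≻^R_λ q),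 R'(p) ≺^R_λ R'(q) = R'(p ≺^R_λ S'(q) + R'(p) ≺^R_λ q), S'(p) ≻^R_λ S'(q) = S'(p ≻^R_λ S'(q) + R'(p) ≻^R_λ q), and S'(p) ≺^R_λ S'(q) = S'(p ≺^R_λ S'(q) + R'(p) ≺^R_λ q) for all p, q ∈ A and λ ∈ ℂ. -/
open scoped TensorProduct

/-- given two Rota-Baxter systems `(R, S)` and `(R', S')` on a
BiHom-associative conformal algebra with `SS' = S'S`, `RS' = S'R`, `SR' = R'S`,
`RR' = R'R`, the pair `(R', S')` is a Rota-Baxter system on the BiHom-dendriform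
conformal algebra `(A, ≺^R, ≻^R, α, β)` where `p ≺^R q = p · S(q)`,
`p ≻^R q = R(p) · q`. -/
theorem two_systems_give_system_on_dendriform (A : Type*) [AddCommGroup A] [Module ℂ A]
    (D α β Rop Sop Rop' Sop' : A →ₗ[ℂ] A) (m : ℂ → A → A → A)
    (hA : BiHomAssocConformal A D α β m)
    (h1 : RotaBaxterSystem A D α β m Rop Sop)
    (h2 : RotaBaxterSystem A D α β m Rop' Sop')
    (hSS' : ∀ p, Sop (Sop' p) = Sop' (Sop p))
    (hRS' : ∀ p, Rop (Sop' p) = Sop' (Rop p))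
    (hSR' : ∀ p, Sop (Rop' p) = Rop' (Sop p))
    (hRR' : ∀ p, Rop (Rop' p) = Rop' (Rop p)) :
    RotaBaxterSystemDendriform A D α β
      (fun l p q => m l p (Sop q)) (fun l p q => m l (Rop p) q) Rop' Sop' := by
  refine ⟨h2.R_D, h2.S_D, h2.R_a, h2.R_b, h2.S_a, h2.S_b, ?_, ?_, ?_, ?_⟩
  · intro l p q
    simp only [hRR']
    rw [h2.rb_R, add_comm]
  · intro l p q
    simp only [hSR', hSS']
    rw [h2.rb_R, add_comm]
  · intro l p q
    simp only [hRR', hRS']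
    rw [h2.rb_S, add_comm]
  · intro l p q
    simp only [hSS']
    rw [h2.rb_S, add_comm]
end
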